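/- arXiv:1110.2918 — 9 statements merged into one kernel-verified Lean document; each statement's English description precedes it below -/
import Mathlib

section
/- Let Q be a commutative ring and f ∈ Q a nonzerodivisor. Let (E₁, E₀, e₁, e₀) be a matrix factorization of f over Q and assume that multiplication by f is injective on E₀ and on E₁ (this holds, for instance, when E₀ and E₁ are projective Q-modules). Then {x ∈ E₀ : e₀(x) ∈ f • E₁} = e₁(E₁) and {x ∈ E₁ : e₁(x) ∈ f • E₀} = e₀(E₀). Equivalently, the doubly infinite two-periodic complex of R = Q/(f)-modules ⋯ → E₁/fE₁ → E₀/fE₀ → E₁/fE₁ → ⋯, whose differentials are induced by e₁ and e₀ alternately, is exact. -/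
/-- Let `Q` be a commutative ring and `f ∈ Q` a nonzerodivisor.
Given a matrix factorization `(E₁, E₀, e₁, e₀)` of `f` over `Q` such that multiplication
by `f` is injective on `E₀` and on `E₁`, the preimage under `e₀` of `f • E₁` is exactly
the image of `e₁`, and the preimage under `e₁` of `f • E₀` is exactly the image of `e₀`
(equivalently, the induced two-periodic complex of `Q/(f)`-modules is exact). -/
theorem stmt_0 (Q : Type*) [CommRing Q] (f : Q) (hf : f ∈ nonZeroDivisors Q)
    (E₁ E₀ : Type*) [AddCommGroup E₁] [AddCommGroup E₀] [Module Q E₁] [Module Q E₀]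
    (e₁ : E₁ →ₗ[Q] E₀) (e₀ : E₀ →ₗ[Q] E₁)
    (h₁ : e₀ ∘ₗ e₁ = f • (LinearMap.id : E₁ →ₗ[Q] E₁))
    (h₂ : e₁ ∘ₗ e₀ = f • (LinearMap.id : E₀ →ₗ[Q] E₀))
    (hE₀ : Function.Injective fun x : E₀ => f • x)
    (hE₁ : Function.Injective fun x : E₁ => f • x) :
    {x : E₀ | ∃ y : E₁, e₀ x = f • y} = Set.range e₁ ∧
    {x : E₁ | ∃ y : E₀, e₁ x = f • y} = Set.range e₀ := by
  have a₁ : ∀ x, e₀ (e₁ x) = f • x := fun x => by simpa using LinearMap.congr_fun h₁ x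
  have a₂ : ∀ x, e₁ (e₀ x) = f • x := fun x => by simpa using LinearMap.congr_fun h₂ x
  constructor
  · ext x
    constructor
    · rintro ⟨y, hy⟩
      refine ⟨y, hE₀ ?_⟩
      change f • e₁ y = f • x
      rw [← a₂ x, hy, map_smul]
    · rintro ⟨y, rfl⟩
      exact ⟨y, a₁ y⟩
  · ext x
    constructor
    · rintro ⟨y, hy⟩
      refine ⟨y, hE₁ ?_⟩
      change f • e₀ y = f • x
      rw [← a₁ x, hy, map_smul]
    · rintro ⟨y, rfl⟩
      exact ⟨y, a₂ y⟩
end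

section
/- Let Q be a commutative ring, f ∈ Q, and let (E₁, E₀, e₁, e₀) be a matrix factorization of f over Q. Suppose there exist Q-linear maps s : E₀ → E₁ and t : E₁ → E₀ with e₁ ∘ s + t ∘ e₀ = id_{E₀} and s ∘ e₁ + e₀ ∘ t = id_{E₁} (a contracting homotopy). Let M = E₀ / e₁(E₁) and note that f • E₀ ⊆ e₁(E₁), so there is a canonical surjective Q-linear map q : E₀ / (f • E₀) → M. Then q admits a Q-linear section, i.e., there exists a Q-linear map j : M → E₀ / (f • E₀) with q ∘ j = id_M. -/
/-- Let `(E₁, E₀, e₁, e₀)` be a matrix factorization of `f` over `Q`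
admitting a contracting homotopy `(s, t)`.  With `M = E₀/e₁(E₁)`, the canonical
surjection `q : E₀/(f•E₀) → M` (induced by the identity, using `f•E₀ ⊆ e₁(E₁)`)
admits a `Q`-linear section. -/
theorem stmt_1 (Q : Type*) [CommRing Q] (f : Q)
    (E₁ E₀ : Type*) [AddCommGroup E₁] [AddCommGroup E₀] [Module Q E₁] [Module Q E₀]
    (e₁ : E₁ →ₗ[Q] E₀) (e₀ : E₀ →ₗ[Q] E₁)
    (h₁ : e₀ ∘ₗ e₁ = f • (LinearMap.id : E₁ →ₗ[Q] E₁))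
    (h₂ : e₁ ∘ₗ e₀ = f • (LinearMap.id : E₀ →ₗ[Q] E₀))
    (s : E₀ →ₗ[Q] E₁) (t : E₁ →ₗ[Q] E₀)
    (hs : e₁ ∘ₗ s + t ∘ₗ e₀ = (LinearMap.id : E₀ →ₗ[Q] E₀))
    (ht : s ∘ₗ e₁ + e₀ ∘ₗ t = (LinearMap.id : E₁ →ₗ[Q] E₁)) :
    ∃ j : (E₀ ⧸ LinearMap.range e₁) →ₗ[Q]
        (E₀ ⧸ LinearMap.range (f • (LinearMap.id : E₀ →ₗ[Q] E₀))),
      (Submodule.mapQ (LinearMap.range (f • (LinearMap.id : E₀ →ₗ[Q] E₀)))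
          (LinearMap.range e₁) LinearMap.id
          (by
            rintro x ⟨y, rfl⟩
            exact ⟨e₀ y, by simpa using LinearMap.congr_fun h₂ y⟩)) ∘ₗ j =
        LinearMap.id := by
  refine ⟨Submodule.mapQ _ _ (t ∘ₗ e₀) ?_, ?_⟩
  · rintro x ⟨y, rfl⟩
    refine ⟨t y, ?_⟩
    have h := LinearMap.congr_fun h₁ y
    simp only [LinearMap.comp_apply, LinearMap.smul_apply, LinearMap.id_apply] at h ⊢
    rw [h, map_smul]
  · apply Submodule.linearMap_qext
    ext x
    have h := LinearMap.congr_fun hs x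
    simp only [LinearMap.add_apply, LinearMap.comp_apply, LinearMap.id_apply,
      Submodule.mkQ_apply, Submodule.mapQ_apply] at h ⊢
    rw [Submodule.Quotient.eq]
    refine ⟨-(s x), ?_⟩
    rw [map_neg]
    nth_rewrite 3 [← h]
    abel
end

section
/- Let Q be a commutative Noetherian ring, f ∈ Q a nonzerodivisor, and let (E₁, E₀, e₁, e₀) be a matrix factorization of f over Q with E₁ and E₀ finitely generated projective Q-modules. Set R = Q/(f) and let M = E₀/e₁(E₁), regarded as an R-module (f • M = 0). Then the following are equivalent: (i) there exist Q-linear maps s : E₀ → E₁ and t : E₁ → E₀ with e₁ ∘ s + t ∘ e₀ = id_{E₀} and s ∘ e₁ + e₀ ∘ t = id_{E₁}; (ii) the canonical surjection E₀/(f • E₀) → M admits a Q-linear section; (iii) M is projective as an R-module. -/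
theorem lift_of_range {Q A P C : Type*} [CommRing Q] [AddCommGroup A] [AddCommGroup P]
    [AddCommGroup C] [Module Q A] [Module Q P] [Module Q C] [Module.Projective Q P]
    (a : A →ₗ[Q] C) (b : P →ₗ[Q] C) (h : ∀ x, b x ∈ LinearMap.range a) :
    ∃ k : P →ₗ[Q] A, ∀ x, a (k x) = b x := by
  obtain ⟨k, hk⟩ := Module.projective_lifting_property a.rangeRestrict
    (b.codRestrict (LinearMap.range a) h) a.surjective_rangeRestrict
  exact ⟨k, fun x => congrArg Subtype.val (LinearMap.congr_fun hk x)⟩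

theorem section_iff_projective {Q : Type*} [CommRing Q] (f : Q)
    {E₀ M : Type*} [AddCommGroup E₀] [Module Q E₀] [Module.Projective Q E₀]
    [AddCommGroup M] [Module Q M]
    [Module (Q ⧸ Ideal.span {f}) M] [IsScalarTower Q (Q ⧸ Ideal.span {f}) M]
    (q : (E₀ ⧸ LinearMap.range (f • (LinearMap.id : E₀ →ₗ[Q] E₀))) →ₗ[Q] M)
    (hq : Function.Surjective q) :
    (∃ j : M →ₗ[Q] (E₀ ⧸ LinearMap.range (f • (LinearMap.id : E₀ →ₗ[Q] E₀))),
      q ∘ₗ j = LinearMap.id) ↔ Module.Projective (Q ⧸ Ideal.span {f}) M := by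
  have hs : Function.Surjective (algebraMap Q (Q ⧸ Ideal.span {f})) :=
    Ideal.Quotient.mk_surjective
  have hE : (Ideal.span {f} • (⊤ : Submodule Q E₀)) =
      LinearMap.range (f • (LinearMap.id : E₀ →ₗ[Q] E₀)) := by
    ext x
    rw [Submodule.ideal_span_singleton_smul, Submodule.mem_smul_pointwise_iff_exists]
    simp
  let φ := (TensorProduct.quotTensorEquivQuotSMul E₀ (Ideal.span {f})).trans
    (Submodule.quotEquivOfEq _ _ hE)
  let π := LinearMap.extendScalarsOfSurjective hs (q ∘ₗ φ.toLinearMap)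
  have hπ : ∀ x, π x = q (φ x) := fun _ => rfl
  constructor
  · rintro ⟨j, hj⟩
    refine Module.Projective.of_split
      (LinearMap.extendScalarsOfSurjective hs (φ.symm.toLinearMap ∘ₗ j)) π ?_
    ext x
    change q (φ (φ.symm (j x))) = x
    rw [φ.apply_symm_apply]
    exact LinearMap.congr_fun hj x
  · intro _
    obtain ⟨i, hi⟩ := Module.projective_lifting_property π LinearMap.id
      (hq.comp φ.surjective)
    refine ⟨φ.toLinearMap ∘ₗ i.restrictScalars Q, ?_⟩
    ext x
    exact LinearMap.congr_fun hi x

/-- For a matrix factorization `(E₁, E₀, e₁, e₀)` of a nonzerodivisor `f`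
over a Noetherian ring `Q`, with `E₁, E₀` finitely generated projective, `R = Q/(f)` and
`M = E₀/e₁(E₁)` regarded as an `R`-module, the following are equivalent:
(i) a contracting homotopy `(s, t)` exists; (ii) the canonical surjection
`E₀/(f•E₀) → M` has a `Q`-linear section; (iii) `M` is projective over `R`. -/
theorem stmt_2 (Q : Type*) [CommRing Q] [IsNoetherianRing Q]
    (f : Q) (hf : f ∈ nonZeroDivisors Q)
    (E₁ E₀ : Type*) [AddCommGroup E₁] [AddCommGroup E₀] [Module Q E₁] [Module Q E₀]
    [Module.Finite Q E₁] [Module.Finite Q E₀]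
    [Module.Projective Q E₁] [Module.Projective Q E₀]
    (e₁ : E₁ →ₗ[Q] E₀) (e₀ : E₀ →ₗ[Q] E₁)
    (h₁ : e₀ ∘ₗ e₁ = f • (LinearMap.id : E₁ →ₗ[Q] E₁))
    (h₂ : e₁ ∘ₗ e₀ = f • (LinearMap.id : E₀ →ₗ[Q] E₀))
    (M : Type*) [AddCommGroup M] [Module Q M]
    [Module (Q ⧸ Ideal.span {f}) M] [IsScalarTower Q (Q ⧸ Ideal.span {f}) M]
    (g : (E₀ ⧸ LinearMap.range e₁) ≃ₗ[Q] M) :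
    ((∃ (s : E₀ →ₗ[Q] E₁) (t : E₁ →ₗ[Q] E₀),
        e₁ ∘ₗ s + t ∘ₗ e₀ = (LinearMap.id : E₀ →ₗ[Q] E₀) ∧
        s ∘ₗ e₁ + e₀ ∘ₗ t = (LinearMap.id : E₁ →ₗ[Q] E₁)) ↔
      (∃ j : M →ₗ[Q] (E₀ ⧸ LinearMap.range (f • (LinearMap.id : E₀ →ₗ[Q] E₀))),
        (g.toLinearMap ∘ₗ
          Submodule.mapQ (LinearMap.range (f • (LinearMap.id : E₀ →ₗ[Q] E₀)))
            (LinearMap.range e₁) LinearMap.id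
            (by
              rintro x ⟨y, rfl⟩
              exact ⟨e₀ y, by simpa using LinearMap.congr_fun h₂ y⟩)) ∘ₗ j =
          LinearMap.id)) ∧
    ((∃ j : M →ₗ[Q] (E₀ ⧸ LinearMap.range (f • (LinearMap.id : E₀ →ₗ[Q] E₀))),
        (g.toLinearMap ∘ₗ
          Submodule.mapQ (LinearMap.range (f • (LinearMap.id : E₀ →ₗ[Q] E₀)))
            (LinearMap.range e₁) LinearMap.id
            (by
              rintro x ⟨y, rfl⟩
              exact ⟨e₀ y, by simpa using LinearMap.congr_fun h₂ y⟩)) ∘ₗ j =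
          LinearMap.id) ↔
      Module.Projective (Q ⧸ Ideal.span {f}) M) := by
  have r₁ : IsSMulRegular E₁ f := Module.Flat.isSMulRegular_of_nonZeroDivisors hf
  have r₀ : IsSMulRegular E₀ f := Module.Flat.isSMulRegular_of_nonZeroDivisors hf
  have k₁ : ∀ x, e₀ (e₁ x) = f • x := fun x => LinearMap.congr_fun h₁ x
  have k₂ : ∀ x, e₁ (e₀ x) = f • x := fun x => LinearMap.congr_fun h₂ x
  have inj₁ : Function.Injective e₁ := fun x y h => r₁ (by
    change f • x = f • y
    rw [← k₁, ← k₁, h])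
  refine ⟨⟨?_, ?_⟩, section_iff_projective f _ ?_⟩
  · rintro ⟨s, t, hst, -⟩
    have hst' : ∀ x, e₁ (s x) + t (e₀ x) = x := fun x => LinearMap.congr_fun hst x
    refine ⟨Submodule.mapQ (LinearMap.range e₁) _ (t ∘ₗ e₀) ?_ ∘ₗ g.symm.toLinearMap, ?_⟩
    · rintro _ ⟨y, rfl⟩
      exact ⟨t y, by simp [k₁]⟩
    · ext m
      obtain ⟨z, rfl⟩ := g.surjective m
      obtain ⟨x, rfl⟩ := Submodule.Quotient.mk_surjective _ z
      simp only [LinearMap.comp_apply, LinearEquiv.coe_coe, LinearEquiv.symm_apply_apply,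
        Submodule.mapQ_apply, LinearMap.id_apply]
      congr 1
      rw [Submodule.Quotient.eq]
      refine ⟨- s x, ?_⟩
      rw [map_neg, neg_eq_iff_eq_neg, neg_sub, eq_sub_iff_add_eq]
      exact hst' x
  · rintro ⟨j, hj⟩
    obtain ⟨p, hp⟩ := lift_of_range
      (Submodule.mkQ (LinearMap.range (f • (LinearMap.id : E₀ →ₗ[Q] E₀))))
      (j ∘ₗ g.toLinearMap ∘ₗ Submodule.mkQ (LinearMap.range e₁))
      (fun x => Submodule.mkQ_surjective _ _)
    obtain ⟨s, hs⟩ := lift_of_range e₁ (LinearMap.id - p) (fun x => by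
      have h := LinearMap.congr_fun hj (g (Submodule.Quotient.mk x))
      have h2 := hp x
      simp only [LinearMap.comp_apply, LinearEquiv.coe_coe, Submodule.mkQ_apply] at h2 h
      rw [← h2] at h
      simp only [Submodule.mapQ_apply, LinearMap.id_apply] at h
      have h3 := g.injective h
      exact (Submodule.Quotient.eq _).1 h3.symm)
    obtain ⟨t, ht⟩ := lift_of_range (f • (LinearMap.id : E₀ →ₗ[Q] E₀)) (p ∘ₗ e₁) (fun y => by
      have h2 := hp (e₁ y)
      have h3 : (Submodule.mkQ (LinearMap.range e₁)) (e₁ y) = 0 := by simp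
      rw [LinearMap.comp_apply, LinearMap.comp_apply, h3, map_zero, map_zero] at h2
      exact (Submodule.Quotient.mk_eq_zero _).1 h2)
    have hs' : ∀ x, e₁ (s x) = x - p x := hs
    have ht' : ∀ y, f • t y = p (e₁ y) := ht
    have hpt : ∀ x, t (e₀ x) = p x := fun x => r₀ (by
      change f • t (e₀ x) = f • p x
      rw [ht', k₂, map_smul])
    refine ⟨s, t, ?_, ?_⟩
    · ext x
      simp [hs', hpt]
    · ext y
      apply inj₁
      simp [hs', k₂, ht']
  · refine g.surjective.comp ?_
    intro z
    obtain ⟨x, rfl⟩ := Submodule.Quotient.mk_surjective _ z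
    exact ⟨Submodule.Quotient.mk x, by simp⟩
end

section
/- Let Q be a commutative ring, f ∈ Q a nonzerodivisor, and let (E₁, E₀, e₁, e₀) be a matrix factorization of f over Q with E₁ and E₀ projective Q-modules. Set R = Q/(f) and M = E₀/e₁(E₁), regarded as an R-module. Then for every R-module N and every integer q ≥ 1 there is an isomorphism of abelian groups Ext_R^{q+2}(M, N) ≅ Ext_R^q(M, N). -/
universe u

open CategoryTheory

namespace MF

section Periodic

universe v w
variable {C : Type w} [Category.{v} C] [Abelian C] {A B Z : C}
  (a : B ⟶ A) (b : A ⟶ B)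

/-- The objects of the two-periodic complex. -/
def perX (A B : C) : ℕ → C
  | 0 => A
  | 1 => B
  | (n + 2) => perX A B n

/-- The differentials of the two-periodic complex. -/
def perd : ∀ n : ℕ, perX A B (n + 1) ⟶ perX A B n
  | 0 => a
  | 1 => b
  | (n + 2) => perd n

theorem perd_comp (hab : a ≫ b = 0) (hba : b ≫ a = 0) :
    ∀ n : ℕ, perd a b (n + 1) ≫ perd a b n = 0
  | 0 => hba
  | 1 => hab
  | (n + 2) => perd_comp hab hba n

theorem perX_projective [Projective A] [Projective B] : ∀ n, Projective (perX A B n)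
  | 0 => inferInstanceAs (Projective A)
  | 1 => inferInstanceAs (Projective B)
  | (n + 2) => perX_projective n

theorem perd_exact (hab : a ≫ b = 0) (hba : b ≫ a = 0)
    (h1 : (ShortComplex.mk a b hab).Exact) (h2 : (ShortComplex.mk b a hba).Exact) :
    ∀ n : ℕ, (ShortComplex.mk _ _ (perd_comp a b hab hba n)).Exact
  | 0 => h2
  | 1 => h1
  | (n + 2) => perd_exact hab hba h1 h2 n

/-- The two-periodic complex. -/
noncomputable def per (hab : a ≫ b = 0) (hba : b ≫ a = 0) : ChainComplex C ℕ :=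
  ChainComplex.of (perX A B) (perd a b) (perd_comp a b hab hba)

theorem per_d (hab : a ≫ b = 0) (hba : b ≫ a = 0) (n : ℕ) :
    (per a b hab hba).d (n + 1) n = perd a b n :=
  ChainComplex.of_d (perX A B) (perd a b) n

theorem per_exactAt (hab : a ≫ b = 0) (hba : b ≫ a = 0)
    (h1 : (ShortComplex.mk a b hab).Exact) (h2 : (ShortComplex.mk b a hba).Exact) (n : ℕ) :
    (per a b hab hba).ExactAt (n + 1) := by
  rw [HomologicalComplex.exactAt_iff' _ (n + 2) (n + 1) n (by simp) (by simp)]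
  refine (ShortComplex.exact_iff_of_iso ?_).2 (perd_exact a b hab hba h1 h2 n)
  refine ShortComplex.isoMk (Iso.refl _) (Iso.refl _) (Iso.refl _) ?_ ?_
  · refine (Category.id_comp _).trans (Eq.trans ?_ (Category.comp_id _).symm)
    exact (per_d a b hab hba (n + 1)).symm
  · refine (Category.id_comp _).trans (Eq.trans ?_ (Category.comp_id _).symm)
    exact (per_d a b hab hba n).symm

/-- The two-periodic projective resolution. -/
noncomputable def perRes [Projective A] [Projective B] (p : A ⟶ Z) [Epi p]
    (hab : a ≫ b = 0) (hba : b ≫ a = 0) (hap : a ≫ p = 0)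
    (h1 : (ShortComplex.mk a b hab).Exact) (h2 : (ShortComplex.mk b a hba).Exact)
    (h3 : (ShortComplex.mk a p hap).Exact) :
    ProjectiveResolution Z where
  complex := per a b hab hba
  projective := perX_projective
  π := (ChainComplex.toSingle₀Equiv _ _).symm ⟨p, by rw [per_d a b hab hba 0]; exact hap⟩
  quasiIso := ⟨fun n => by
    cases n
    · rw [ChainComplex.quasiIsoAt₀_iff, ShortComplex.quasiIso_iff_of_zeros']
      · refine (ShortComplex.exact_and_epi_g_iff_of_iso ?_).2
          ⟨h3, by dsimp; infer_instance⟩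
        refine ShortComplex.isoMk (Iso.refl _) (Iso.refl _) (Iso.refl _) ?_ ?_
        · refine (Category.id_comp _).trans (Eq.trans ?_ (Category.comp_id _).symm)
          exact (per_d a b hab hba 0).symm
        · refine (Category.id_comp _).trans (Eq.trans ?_ (Category.comp_id _).symm)
          exact (ChainComplex.toSingle₀Equiv_symm_apply_f_zero
            (C := per a b hab hba) (X := Z) p _).symm
      all_goals rfl
    · rw [quasiIsoAt_iff_exactAt']
      · apply per_exactAt a b hab hba h1 h2
      · apply ChainComplex.exactAt_succ_single_obj⟩

theorem ext_per {R : Type*} [Ring R] [Linear R C] [EnoughProjectives C]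
    [Projective A] [Projective B] (p : A ⟶ Z) [Epi p]
    (hab : a ≫ b = 0) (hba : b ≫ a = 0) (hap : a ≫ p = 0)
    (h1 : (ShortComplex.mk a b hab).Exact) (h2 : (ShortComplex.mk b a hba).Exact)
    (h3 : (ShortComplex.mk a p hap).Exact) (N : C) (n : ℕ) :
    Nonempty (((Ext R C (n + 3)).obj (Opposite.op Z)).obj N ≅
      ((Ext R C (n + 1)).obj (Opposite.op Z)).obj N) := by
  let P := perRes a b p hab hba hap h1 h2 h3
  let K := P.complex.linearYonedaObj R N
  have hd (m : ℕ) : K.d (m + 2) (m + 3) = K.d m (m + 1) := by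
    have e : P.complex.d (m + 3) (m + 2) = P.complex.d (m + 1) m :=
      (per_d a b hab hba (m + 2)).trans (per_d a b hab hba m).symm
    exact congrArg (fun t => ((linearYoneda R C).obj N).map (Quiver.Hom.op t)) e
  let i1 := K.homologyIsoSc' (n + 2) (n + 3) (n + 4) (by simp) (by simp)
  let i2 := K.homologyIsoSc' n (n + 1) (n + 2) (by simp) (by simp)
  have i3 : K.sc' (n + 2) (n + 3) (n + 4) ≅ K.sc' n (n + 1) (n + 2) := by
    refine ShortComplex.isoMk (Iso.refl _) (Iso.refl _) (Iso.refl _) ?_ ?_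
    · refine (Category.id_comp _).trans (Eq.trans ?_ (Category.comp_id _).symm)
      exact (hd n).symm
    · refine (Category.id_comp _).trans (Eq.trans ?_ (Category.comp_id _).symm)
      exact (hd (n + 1)).symm
  exact ⟨P.isoExt (n + 3) N ≪≫ i1 ≪≫ ShortComplex.homologyMapIso i3 ≪≫ i2.symm ≪≫
    (P.isoExt (n + 1) N).symm⟩

end Periodic

section Mod

variable {Q : Type u} [CommRing Q] {f : Q}

/-- Reduction of a module modulo `f`. -/
abbrev Red (f : Q) (E : Type u) [AddCommGroup E] [Module Q E] : Type u :=
  E ⧸ (Ideal.span {f} • (⊤ : Submodule Q E))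

theorem surj (f : Q) : Function.Surjective (algebraMap Q (Q ⧸ Ideal.span {f})) :=
  Ideal.Quotient.mk_surjective

variable {E E' : Type u} [AddCommGroup E] [Module Q E] [AddCommGroup E'] [Module Q E']

theorem mem_red {x : E} : x ∈ (Ideal.span {f} • (⊤ : Submodule Q E)) ↔ ∃ y, f • y = x := by
  rw [Submodule.ideal_span_singleton_smul, Submodule.mem_smul_pointwise_iff_exists]
  simp

instance red_projective [Module.Projective Q E] :
    Module.Projective (Q ⧸ Ideal.span {f}) (Red f E) :=
  Module.Projective.of_equiv
    ((TensorProduct.quotTensorEquivQuotSMul E (Ideal.span {f})).extendScalarsOfSurjective (surj f))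

/-- Reduction of a linear map modulo `f`. -/
def redMap (f : Q) (e : E →ₗ[Q] E') : Red f E →ₗ[Q ⧸ Ideal.span {f}] Red f E' :=
  (Submodule.mapQ _ _ e (by
    intro x hx
    obtain ⟨y, rfl⟩ := mem_red.1 hx
    exact mem_red.2 ⟨e y, by simp⟩)).extendScalarsOfSurjective (surj f)

theorem redMap_mk (e : E →ₗ[Q] E') (x : E) :
    redMap f e (Submodule.Quotient.mk x) = Submodule.Quotient.mk (e x) := rfl

theorem redMap_comp (e : E →ₗ[Q] E') (e' : E' →ₗ[Q] E) (h : e' ∘ₗ e = f • LinearMap.id) :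
    ModuleCat.ofHom (redMap f e) ≫ ModuleCat.ofHom (redMap f e') = 0 := by
  refine ModuleCat.hom_ext (LinearMap.ext fun x => ?_)
  obtain ⟨x, rfl⟩ := Submodule.Quotient.mk_surjective _ x
  change redMap f e' (redMap f e (Submodule.Quotient.mk x)) = 0
  rw [redMap_mk, redMap_mk, Submodule.Quotient.mk_eq_zero, mem_red]
  exact ⟨x, (LinearMap.congr_fun h x).symm⟩

theorem redMap_exact (hf : f ∈ nonZeroDivisors Q) [Module.Projective Q E']
    (e : E →ₗ[Q] E') (e' : E' →ₗ[Q] E)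
    (h : e' ∘ₗ e = f • LinearMap.id) (h' : e ∘ₗ e' = f • LinearMap.id) :
    (ShortComplex.mk _ _ (redMap_comp e e' h)).Exact := by
  rw [ShortComplex.moduleCat_exact_iff]
  intro x hx
  obtain ⟨x, rfl⟩ := Submodule.Quotient.mk_surjective _ x
  change redMap f e' (Submodule.Quotient.mk x) = 0 at hx
  rw [redMap_mk, Submodule.Quotient.mk_eq_zero, mem_red] at hx
  obtain ⟨y, hy⟩ := hx
  refine ⟨(Submodule.Quotient.mk y : Red f E), ?_⟩
  change redMap f e (Submodule.Quotient.mk y) = _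
  rw [redMap_mk]
  congr 1
  apply Module.Flat.isSMulRegular_of_nonZeroDivisors (M := E') hf
  have := LinearMap.congr_fun h' x
  simp only [LinearMap.comp_apply, ← hy, map_smul, LinearMap.smul_apply, LinearMap.id_apply] at this
  exact this

end Mod

end MF

/-- For a matrix factorization `(E₁, E₀, e₁, e₀)` of a nonzerodivisor `f`
over `Q`, with `E₁, E₀` projective `Q`-modules, `R = Q/(f)` and `M = E₀/e₁(E₁)` regarded
as an `R`-module, for every `R`-module `N` and every `q ≥ 1` there is an isomorphism of
abelian groups `Ext_R^{q+2}(M, N) ≅ Ext_R^q(M, N)`. -/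
theorem stmt_3 (Q : Type u) [CommRing Q] (f : Q) (hf : f ∈ nonZeroDivisors Q)
    (E₁ E₀ : Type u) [AddCommGroup E₁] [AddCommGroup E₀] [Module Q E₁] [Module Q E₀]
    [Module.Projective Q E₁] [Module.Projective Q E₀]
    (e₁ : E₁ →ₗ[Q] E₀) (e₀ : E₀ →ₗ[Q] E₁)
    (h₁ : e₀ ∘ₗ e₁ = f • (LinearMap.id : E₁ →ₗ[Q] E₁))
    (h₂ : e₁ ∘ₗ e₀ = f • (LinearMap.id : E₀ →ₗ[Q] E₀))
    (M : Type u) [AddCommGroup M] [Module Q M]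
    [Module (Q ⧸ Ideal.span {f}) M] [IsScalarTower Q (Q ⧸ Ideal.span {f}) M]
    (g : (E₀ ⧸ LinearMap.range e₁) ≃ₗ[Q] M)
    (N : Type u) [AddCommGroup N] [Module (Q ⧸ Ideal.span {f}) N]
    (q : ℕ) (hq : 1 ≤ q) :
    Nonempty
      ((((Ext (Q ⧸ Ideal.span {f}) (ModuleCat.{u} (Q ⧸ Ideal.span {f})) (q + 2)).obj
            (Opposite.op (ModuleCat.of (Q ⧸ Ideal.span {f}) M))).obj
          (ModuleCat.of (Q ⧸ Ideal.span {f}) N)) ≃+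
        (((Ext (Q ⧸ Ideal.span {f}) (ModuleCat.{u} (Q ⧸ Ideal.span {f})) q).obj
            (Opposite.op (ModuleCat.of (Q ⧸ Ideal.span {f}) M))).obj
          (ModuleCat.of (Q ⧸ Ideal.span {f}) N))) := by
  classical
  obtain ⟨n, rfl⟩ : ∃ n, q = n + 1 := ⟨q - 1, by omega⟩
  let p0 : MF.Red f E₀ →ₗ[Q] M := Submodule.liftQ _ (g.toLinearMap ∘ₗ Submodule.mkQ _) (by
    intro x hx
    obtain ⟨y, rfl⟩ := MF.mem_red.1 hx
    have hy : f • y ∈ LinearMap.range e₁ := ⟨e₀ y, LinearMap.congr_fun h₂ y⟩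
    simp only [LinearMap.mem_ker, LinearMap.comp_apply, Submodule.mkQ_apply]
    rw [(Submodule.Quotient.mk_eq_zero _).2 hy]
    exact map_zero _)
  have hp0 (x : E₀) : p0 (Submodule.Quotient.mk x) = g (Submodule.Quotient.mk x) := rfl
  let p := p0.extendScalarsOfSurjective (MF.surj f)
  have hp (x : E₀) : p (Submodule.Quotient.mk x) = g (Submodule.Quotient.mk x) := rfl
  have hps : Function.Surjective p := by
    intro m
    obtain ⟨x, hx⟩ := Submodule.Quotient.mk_surjective _ (g.symm m)
    exact ⟨Submodule.Quotient.mk x, by rw [hp, hx]; simp⟩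
  have : Epi (ModuleCat.ofHom p) := (ModuleCat.epi_iff_surjective _).2 hps
  have : Projective (ModuleCat.of (Q ⧸ Ideal.span {f}) (MF.Red f E₀)) :=
    (IsProjective.iff_projective _).1 inferInstance
  have : Projective (ModuleCat.of (Q ⧸ Ideal.span {f}) (MF.Red f E₁)) :=
    (IsProjective.iff_projective _).1 inferInstance
  have hap : ModuleCat.ofHom (MF.redMap f e₁) ≫ ModuleCat.ofHom p = 0 := by
    refine ModuleCat.hom_ext (LinearMap.ext fun x => ?_)
    obtain ⟨x, rfl⟩ := Submodule.Quotient.mk_surjective _ x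
    change p (MF.redMap f e₁ (Submodule.Quotient.mk x)) = 0
    rw [MF.redMap_mk, hp, (Submodule.Quotient.mk_eq_zero _).2 (LinearMap.mem_range_self e₁ x)]
    exact map_zero _
  have h3 : (ShortComplex.mk _ _ hap).Exact := by
    rw [ShortComplex.moduleCat_exact_iff]
    intro x hx
    obtain ⟨x, rfl⟩ := Submodule.Quotient.mk_surjective _ x
    change p (Submodule.Quotient.mk x) = 0 at hx
    rw [hp, LinearEquiv.map_eq_zero_iff, Submodule.Quotient.mk_eq_zero] at hx
    obtain ⟨y, rfl⟩ := hx
    exact ⟨(Submodule.Quotient.mk y : MF.Red f E₁), rfl⟩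
  obtain ⟨i⟩ := MF.ext_per (R := Q ⧸ Ideal.span {f}) _ _ (ModuleCat.ofHom p) _ _ hap
    (MF.redMap_exact hf e₁ e₀ h₁ h₂) (MF.redMap_exact hf e₀ e₁ h₂ h₁) h3
    (ModuleCat.of (Q ⧸ Ideal.span {f}) N) n
  exact ⟨i.toLinearEquiv.toAddEquiv⟩
end

section
/- Let Q be a commutative ring, f ∈ Q a nonzerodivisor, and let (E₁, E₀, e₁, e₀) be a matrix factorization of f over Q with E₁ and E₀ finitely generated projective Q-modules. Set R = Q/(f) and M = E₀/e₁(E₁), regarded as an R-module. Then for every finitely generated projective R-module P and every integer j ≥ 1, Ext_R^j(M, P) = 0. -/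
universe u
open CategoryTheory

section
variable {R : Type u} [CommRing R] {F : Type u} [AddCommGroup F] [Module R F]

noncomputable def perCx (d : F →ₗ[R] F) (hd : d ∘ₗ d = 0) : ChainComplex (ModuleCat.{u} R) ℕ :=
  ChainComplex.of (fun _ => ModuleCat.of R F) (fun _ => ModuleCat.ofHom d)
    (fun _ => by rw [← ModuleCat.ofHom_comp, hd]; rfl)

lemma perCx_d (d : F →ₗ[R] F) (hd : d ∘ₗ d = 0) (n : ℕ) :
    (perCx d hd).d (n + 1) n = ModuleCat.ofHom d := by
  unfold perCx
  exact ChainComplex.of_d (fun _ : ℕ => ModuleCat.of R F) (fun _ => ModuleCat.ofHom d) n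

noncomputable def perPi (d : F →ₗ[R] F) (hd : d ∘ₗ d = 0) :
    perCx d hd ⟶ (ChainComplex.single₀ (ModuleCat.{u} R)).obj
      (ModuleCat.of R (F ⧸ LinearMap.range d)) :=
  ((perCx d hd).toSingle₀Equiv _).symm ⟨ModuleCat.ofHom (LinearMap.range d).mkQ, by
    have h := perCx_d d hd 0
    rw [zero_add] at h
    rw [h]
    ext x
    exact (Submodule.Quotient.mk_eq_zero _).2 ⟨x, rfl⟩⟩

lemma perPi_f (d : F →ₗ[R] F) (hd : d ∘ₗ d = 0) :
    (perPi d hd).f 0 = ModuleCat.ofHom (LinearMap.range d).mkQ := by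
  unfold perPi
  exact ChainComplex.toSingle₀Equiv_symm_apply_f_zero _ _

lemma perPi_quasiIso (d : F →ₗ[R] F) (hd : d ∘ₗ d = 0)
    (hex : ∀ x, d x = 0 → ∃ y, d y = x) : QuasiIso (perPi d hd) where
  quasiIsoAt m := by
    cases m with
    | zero =>
      rw [ChainComplex.quasiIsoAt₀_iff, ShortComplex.quasiIso_iff_of_zeros' _ rfl rfl rfl]
      constructor
      · rw [ShortComplex.moduleCat_exact_iff]
        intro x hx
        have h := perCx_d d hd 0
        have hx' : (LinearMap.range d).mkQ x = 0 := by
          change ((perPi d hd).f 0).hom x = 0 at hx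
          rw [perPi_f] at hx
          exact hx
        obtain ⟨y, hy⟩ := (Submodule.Quotient.mk_eq_zero _).1 hx'
        refine ⟨y, ?_⟩
        change ((perCx d hd).d (0+1) 0).hom y = x
        rw [h]
        exact hy
      · rw [ModuleCat.epi_iff_surjective]
        intro x
        obtain ⟨y, rfl⟩ := (LinearMap.range d).mkQ_surjective x
        refine ⟨y, ?_⟩
        change ((perPi d hd).f 0).hom y = _
        rw [perPi_f]
        rfl
    | succ m =>
      rw [quasiIsoAt_iff_exactAt' (hL := ChainComplex.exactAt_succ_single_obj ..),
          HomologicalComplex.exactAt_iff' _ (m + 1 + 1) (m + 1) m (by simp) (by simp)]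
      rw [ShortComplex.moduleCat_exact_iff]
      intro x hx
      have hx' : d x = 0 := by
        change ((perCx d hd).d (m+1) m).hom x = 0 at hx
        rw [perCx_d] at hx
        exact hx
      obtain ⟨y, hy⟩ := hex x hx'
      refine ⟨y, ?_⟩
      change ((perCx d hd).d (m+1+1) (m+1)).hom y = x
      rw [perCx_d]
      exact hy

noncomputable def perRes [Module.Projective R F] (d : F →ₗ[R] F) (hd : d ∘ₗ d = 0)
    (hex : ∀ x, d x = 0 → ∃ y, d y = x) :
    ProjectiveResolution (ModuleCat.of R (F ⧸ LinearMap.range d)) where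
  complex := perCx d hd
  projective _ := inferInstanceAs (Projective (ModuleCat.of R F))
  π := perPi d hd
  quasiIso := perPi_quasiIso d hd hex

lemma ext_per [Module.Projective R F] (d : F →ₗ[R] F) (hd : d ∘ₗ d = 0)
    (hex : ∀ x, d x = 0 → ∃ y, d y = x) (P : Type u) [AddCommGroup P] [Module R P]
    (hP : ∀ φ : F →ₗ[R] P, φ ∘ₗ d = 0 → ∃ ψ : F →ₗ[R] P, ψ ∘ₗ d = φ) (n : ℕ) :
    Limits.IsZero (((Ext R (ModuleCat.{u} R) (n + 1)).obj
      (Opposite.op (ModuleCat.of R (F ⧸ LinearMap.range d)))).obj (ModuleCat.of R P)) := by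
  refine Limits.IsZero.of_iso ?_ ((perRes d hd hex).isoExt (n + 1) _)
  rw [← HomologicalComplex.exactAt_iff_isZero_homology,
    HomologicalComplex.exactAt_iff' _ n (n + 1) (n + 1 + 1) (by simp) (by simp),
    ShortComplex.moduleCat_exact_iff]
  intro (x : ModuleCat.of R F ⟶ ModuleCat.of R P) hx
  have hx1 : (perCx d hd).d (n + 1 + 1) (n + 1) ≫ x = 0 := hx
  rw [perCx_d] at hx1
  obtain ⟨ψ, hψ⟩ := hP x.hom (congrArg ModuleCat.Hom.hom hx1)
  refine ⟨(ModuleCat.ofHom ψ : ModuleCat.of R F ⟶ ModuleCat.of R P), ?_⟩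
  change (perCx d hd).d (n + 1) n ≫ ModuleCat.ofHom ψ = x
  rw [perCx_d]
  ext1
  exact hψ

lemma ext_retract (M N P : ModuleCat.{u} R) (i : M ⟶ N) (p : N ⟶ M) (h : i ≫ p = 𝟙 M) (n : ℕ)
    (hN : Limits.IsZero (((Ext R (ModuleCat.{u} R) n).obj (Opposite.op N)).obj P)) :
    Limits.IsZero (((Ext R (ModuleCat.{u} R) n).obj (Opposite.op M)).obj P) := by
  rw [Limits.IsZero.iff_id_eq_zero]
  have : 𝟙 (((Ext R (ModuleCat.{u} R) n).obj (Opposite.op M)).obj P) =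
      ((Ext R (ModuleCat.{u} R) n).map p.op).app P ≫ ((Ext R (ModuleCat.{u} R) n).map i.op).app P := by
    rw [← NatTrans.comp_app, ← Functor.map_comp, ← op_comp, h]
    simp
  rw [this, hN.eq_of_tgt (((Ext R (ModuleCat.{u} R) n).map p.op).app P) 0, Limits.zero_comp]
end

section
variable {Q : Type u} [CommRing Q] {f : Q} (hf : f ∈ nonZeroDivisors Q)
  {E : Type u} [AddCommGroup E] [Module Q E] [Module.Projective Q E]
open TensorProduct

lemma smul_inj (hf : f ∈ nonZeroDivisors Q) (x : E) (h : f • x = 0) : x = 0 := by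
  obtain ⟨s, hs⟩ := (Module.projective_def' (R := Q) (P := E)).1 inferInstance
  have hx : s x = 0 := by
    have : f • s x = 0 := by rw [← map_smul, h, map_zero]
    ext a
    have := DFunLike.congr_fun this a
    simp only [Finsupp.smul_apply, smul_eq_mul, Finsupp.zero_apply] at this ⊢
    exact (mem_nonZeroDivisors_iff.1 hf).1 _ this
  have := LinearMap.congr_fun hs x
  simpa [hx] using this.symm

lemma one_tmul_surj (z : (Q ⧸ Ideal.span {f}) ⊗[Q] E) : ∃ x : E, z = 1 ⊗ₜ[Q] x := by
  induction z with
  | zero => exact ⟨0, by simp⟩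
  | tmul r x =>
    obtain ⟨q, rfl⟩ := Ideal.Quotient.mk_surjective r
    refine ⟨q • x, ?_⟩
    rw [← TensorProduct.smul_tmul, Algebra.smul_def, mul_one]
    rfl
  | add a b ha hb =>
    obtain ⟨x, rfl⟩ := ha
    obtain ⟨y, rfl⟩ := hb
    exact ⟨x + y, by rw [TensorProduct.tmul_add]⟩

lemma one_tmul_zero (x : E) (h : (1 : Q ⧸ Ideal.span {f}) ⊗ₜ[Q] x = 0) : ∃ y, x = f • y := by
  have := congrArg (TensorProduct.quotTensorEquivQuotSMul E (Ideal.span {f})) h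
  rw [map_zero, ← map_one (Ideal.Quotient.mk (Ideal.span {f})),
    TensorProduct.quotTensorEquivQuotSMul_mk_tmul, Submodule.Quotient.mk_eq_zero,
    one_smul, Submodule.ideal_span_singleton_smul] at this
  obtain ⟨y, -, hy⟩ := this
  exact ⟨y, hy.symm⟩

lemma f_tmul (x : E) : (1 : Q ⧸ Ideal.span {f}) ⊗ₜ[Q] (f • x) = 0 := by
  rw [← TensorProduct.smul_tmul, Algebra.smul_def, mul_one]
  have : algebraMap Q (Q ⧸ Ideal.span {f}) f = 0 :=
    Ideal.Quotient.eq_zero_iff_mem.2 (Ideal.mem_span_singleton_self f)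
  rw [this, TensorProduct.zero_tmul]

lemma exact_bc (hf : f ∈ nonZeroDivisors Q) (D : E →ₗ[Q] E) (hD : ∀ x, D (D x) = f • x)
    (z : (Q ⧸ Ideal.span {f}) ⊗[Q] E) (hz : D.baseChange (Q ⧸ Ideal.span {f}) z = 0) :
    ∃ y, D.baseChange (Q ⧸ Ideal.span {f}) y = z := by
  obtain ⟨x, rfl⟩ := one_tmul_surj z
  rw [LinearMap.baseChange_tmul] at hz
  obtain ⟨y, hy⟩ := one_tmul_zero _ hz
  refine ⟨1 ⊗ₜ y, ?_⟩
  rw [LinearMap.baseChange_tmul]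
  congr 1
  have h1 : D (D y - x) = 0 := by rw [map_sub, hD, hy, sub_self]
  have h2 : D y - x = 0 := smul_inj hf _ (by rw [← hD, h1, map_zero])
  exact sub_eq_zero.1 h2

lemma factor_aux (hf : f ∈ nonZeroDivisors Q) (D : E →ₗ[Q] E) (hD : ∀ x, D (D x) = f • x)
    (φ' : E →ₗ[Q] Q) (key : ∀ x, ∃ t, φ' (D x) = f * t) :
    ∃ Θ : E →ₗ[Q] Q, ∀ x, Θ (D x) = φ' x := by
  choose θ hθ using key
  have canc : ∀ a b : Q, f * a = f * b → a = b := fun a b h => by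
    have : f * (a - b) = 0 := by rw [mul_sub, h, sub_self]
    exact sub_eq_zero.1 ((mem_nonZeroDivisors_iff.1 hf).1 _ this)
  let Θ : E →ₗ[Q] Q :=
    { toFun := θ
      map_add' := fun x y => canc _ _ (by rw [← hθ, mul_add, ← hθ, ← hθ, map_add, map_add])
      map_smul' := fun q x => canc _ _ (by
        rw [← hθ, map_smul, map_smul, hθ, RingHom.id_apply, smul_eq_mul, smul_eq_mul]; ring) }
  have hΘ : ∀ x, Θ (D x) = φ' x := fun x => canc _ _ (by
    change f * θ (D x) = _
    rw [← hθ, hD, map_smul, smul_eq_mul])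
  exact ⟨Θ, hΘ⟩

lemma lift_aux (φ : (Q ⧸ Ideal.span {f}) ⊗[Q] E →ₗ[Q ⧸ Ideal.span {f}] (Q ⧸ Ideal.span {f})) :
    ∃ φ' : E →ₗ[Q] Q, ∀ x, algebraMap Q (Q ⧸ Ideal.span {f}) (φ' x) = φ (1 ⊗ₜ x) := by
  obtain ⟨φ', hφ'⟩ := Module.projective_lifting_property
    (Algebra.linearMap Q (Q ⧸ Ideal.span {f}))
    (φ.restrictScalars Q ∘ₗ TensorProduct.mk Q (Q ⧸ Ideal.span {f}) E 1)
    Ideal.Quotient.mk_surjective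
  exact ⟨φ', fun x => LinearMap.congr_fun hφ' x⟩

lemma factor_one (hf : f ∈ nonZeroDivisors Q) (D : E →ₗ[Q] E) (hD : ∀ x, D (D x) = f • x)
    (φ : (Q ⧸ Ideal.span {f}) ⊗[Q] E →ₗ[Q ⧸ Ideal.span {f}] (Q ⧸ Ideal.span {f}))
    (hφ : φ ∘ₗ D.baseChange (Q ⧸ Ideal.span {f}) = 0) :
    ∃ ψ : (Q ⧸ Ideal.span {f}) ⊗[Q] E →ₗ[Q ⧸ Ideal.span {f}] (Q ⧸ Ideal.span {f}),
      ψ ∘ₗ D.baseChange (Q ⧸ Ideal.span {f}) = φ := by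
  obtain ⟨φ', hφ'⟩ := lift_aux φ
  have key : ∀ x, ∃ t, φ' (D x) = f * t := by
    intro x
    have h1 : algebraMap Q (Q ⧸ Ideal.span {f}) (φ' (D x)) = 0 := by
      rw [hφ', ← LinearMap.baseChange_tmul]
      exact LinearMap.congr_fun hφ (1 ⊗ₜ x)
    exact Ideal.mem_span_singleton.1 (Ideal.Quotient.eq_zero_iff_mem.1 h1)
  obtain ⟨Θ, hΘ⟩ := factor_aux hf D hD φ' key
  refine ⟨(Algebra.linearMap Q (Q ⧸ Ideal.span {f}) ∘ₗ Θ).liftBaseChange _, ?_⟩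
  refine LinearMap.ext fun z => ?_
  obtain ⟨x, rfl⟩ := one_tmul_surj z
  rw [LinearMap.comp_apply, LinearMap.baseChange_tmul, LinearMap.liftBaseChange_tmul, one_smul,
    LinearMap.comp_apply, hΘ, Algebra.linearMap_apply, hφ']

lemma factor (hf : f ∈ nonZeroDivisors Q) (D : E →ₗ[Q] E) (hD : ∀ x, D (D x) = f • x)
    (P : Type u) [AddCommGroup P] [Module (Q ⧸ Ideal.span {f}) P]
    [Module.Finite (Q ⧸ Ideal.span {f}) P] [Module.Projective (Q ⧸ Ideal.span {f}) P]
    (φ : (Q ⧸ Ideal.span {f}) ⊗[Q] E →ₗ[Q ⧸ Ideal.span {f}] P)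
    (hφ : φ ∘ₗ D.baseChange (Q ⧸ Ideal.span {f}) = 0) :
    ∃ ψ : (Q ⧸ Ideal.span {f}) ⊗[Q] E →ₗ[Q ⧸ Ideal.span {f}] P,
      ψ ∘ₗ D.baseChange (Q ⧸ Ideal.span {f}) = φ := by
  obtain ⟨n, p, i, -, -, hpi⟩ := Module.Finite.exists_comp_eq_id_of_projective (Q ⧸ Ideal.span {f}) P
  have := fun k : Fin n => factor_one hf D hD (LinearMap.proj k ∘ₗ i ∘ₗ φ)
    (by rw [LinearMap.comp_assoc, LinearMap.comp_assoc, hφ, LinearMap.comp_zero, LinearMap.comp_zero])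
  choose ψ hψ using this
  refine ⟨p ∘ₗ LinearMap.pi ψ, ?_⟩
  have h2 : LinearMap.pi ψ ∘ₗ D.baseChange (Q ⧸ Ideal.span {f}) = i ∘ₗ φ := by
    refine LinearMap.ext fun x => funext fun k => ?_
    exact LinearMap.congr_fun (hψ k) x
  rw [LinearMap.comp_assoc, h2, ← LinearMap.comp_assoc, hpi, LinearMap.id_comp]
end

open TensorProduct in
theorem stmt_4 (Q : Type u) [CommRing Q] (f : Q) (hf : f ∈ nonZeroDivisors Q)
    (E₁ E₀ : Type u) [AddCommGroup E₁] [AddCommGroup E₀] [Module Q E₁] [Module Q E₀]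
    [Module.Finite Q E₁] [Module.Finite Q E₀]
    [Module.Projective Q E₁] [Module.Projective Q E₀]
    (e₁ : E₁ →ₗ[Q] E₀) (e₀ : E₀ →ₗ[Q] E₁)
    (h₁ : e₀ ∘ₗ e₁ = f • (LinearMap.id : E₁ →ₗ[Q] E₁))
    (h₂ : e₁ ∘ₗ e₀ = f • (LinearMap.id : E₀ →ₗ[Q] E₀))
    (M : Type u) [AddCommGroup M] [Module Q M]
    [Module (Q ⧸ Ideal.span {f}) M] [IsScalarTower Q (Q ⧸ Ideal.span {f}) M]
    (g : (E₀ ⧸ LinearMap.range e₁) ≃ₗ[Q] M)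
    (P : Type u) [AddCommGroup P] [Module (Q ⧸ Ideal.span {f}) P]
    [Module.Finite (Q ⧸ Ideal.span {f}) P] [Module.Projective (Q ⧸ Ideal.span {f}) P]
    (j : ℕ) (hj : 1 ≤ j) :
    Subsingleton
      ((((Ext (Q ⧸ Ideal.span {f}) (ModuleCat.{u} (Q ⧸ Ideal.span {f})) j).obj
            (Opposite.op (ModuleCat.of (Q ⧸ Ideal.span {f}) M))).obj
          (ModuleCat.of (Q ⧸ Ideal.span {f}) P))) := by
  obtain ⟨n, rfl⟩ : ∃ n, j = n + 1 := ⟨j - 1, by omega⟩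
  rw [← ModuleCat.isZero_iff_subsingleton]
  let D : (E₀ × E₁) →ₗ[Q] (E₀ × E₁) :=
    (e₁ ∘ₗ LinearMap.snd Q E₀ E₁).prod (e₀ ∘ₗ LinearMap.fst Q E₀ E₁)
  have hD : ∀ x, D (D x) = f • x := fun x =>
    Prod.ext (LinearMap.congr_fun h₂ x.1) (LinearMap.congr_fun h₁ x.2)
  let d := D.baseChange (Q ⧸ Ideal.span {f})
  have hd : d ∘ₗ d = 0 := by
    refine LinearMap.ext fun z => ?_
    obtain ⟨x, rfl⟩ := one_tmul_surj z
    simp only [d, LinearMap.comp_apply, LinearMap.baseChange_tmul, hD, f_tmul]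
    rfl
  have hz := ext_per d hd (exact_bc hf D hD) P (factor hf D hD P) n
  have hs : Function.Surjective (algebraMap Q (Q ⧸ Ideal.span {f})) := Ideal.Quotient.mk_surjective
  -- the inclusion
  let i0 : E₀ →ₗ[Q] (((Q ⧸ Ideal.span {f}) ⊗[Q] (E₀ × E₁)) ⧸ LinearMap.range d) :=
    (LinearMap.range d).mkQ.restrictScalars Q ∘ₗ
      TensorProduct.mk Q (Q ⧸ Ideal.span {f}) (E₀ × E₁) 1 ∘ₗ LinearMap.inl Q E₀ E₁
  have hi0 : LinearMap.range e₁ ≤ LinearMap.ker i0 := by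
    rintro _ ⟨y, rfl⟩
    refine (Submodule.Quotient.mk_eq_zero _).2 ⟨1 ⊗ₜ (0, y), ?_⟩
    simp [d, D]
  let i := (((LinearMap.range e₁).liftQ i0 hi0) ∘ₗ g.symm.toLinearMap).extendScalarsOfSurjective hs
  let p0 : (E₀ × E₁) →ₗ[Q] M := g.toLinearMap ∘ₗ (LinearMap.range e₁).mkQ ∘ₗ LinearMap.fst Q E₀ E₁
  have hp0 : LinearMap.range d ≤ LinearMap.ker (p0.liftBaseChange (Q ⧸ Ideal.span {f})) := by
    rintro _ ⟨z, rfl⟩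
    obtain ⟨x, rfl⟩ := one_tmul_surj z
    simp [d, p0, D]
  let p := (LinearMap.range d).liftQ _ hp0
  refine ext_retract _ _ _ (ModuleCat.ofHom i) (ModuleCat.ofHom p) ?_ _ hz
  ext m
  obtain ⟨x, rfl⟩ := g.surjective m
  obtain ⟨x, rfl⟩ := Submodule.mkQ_surjective _ x
  simp [i, p, i0, p0]
end

section
/- Let Q be a commutative ring, f ∈ Q, and let 0 → E₁ →^{e₁} E₀ →^{π} M → 0 be a short exact sequence of Q-modules (so e₁ is injective, π is surjective, and ker(π) = e₁(E₁)). Assume f • M = 0. Then there exists a unique Q-linear map e₀ : E₀ → E₁ with e₁ ∘ e₀ = f • id_{E₀}, and this map moreover satisfies e₀ ∘ e₁ = f • id_{E₁}. In particular (E₁, E₀, e₁, e₀) is a matrix factorization of f over Q whose cokernel E₀/e₁(E₁) is isomorphic to M. -/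
/-- Given a short exact sequence `0 → E₁ → E₀ → M → 0` of `Q`-modules
with `f • M = 0`, there exists a unique `Q`-linear map `e₀ : E₀ → E₁` with
`e₁ ∘ e₀ = f • id`; moreover any such map satisfies `e₀ ∘ e₁ = f • id`, so
`(E₁, E₀, e₁, e₀)` is a matrix factorization of `f` with cokernel isomorphic to `M`. -/
theorem stmt_5 (Q : Type*) [CommRing Q] (f : Q)
    (E₁ E₀ M : Type*) [AddCommGroup E₁] [AddCommGroup E₀] [AddCommGroup M]
    [Module Q E₁] [Module Q E₀] [Module Q M]
    (e₁ : E₁ →ₗ[Q] E₀) (π : E₀ →ₗ[Q] M)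
    (hinj : Function.Injective e₁) (hsurj : Function.Surjective π)
    (hker : LinearMap.ker π = LinearMap.range e₁)
    (hM : ∀ m : M, f • m = 0) :
    (∃! e₀ : E₀ →ₗ[Q] E₁, e₁ ∘ₗ e₀ = f • (LinearMap.id : E₀ →ₗ[Q] E₀)) ∧
    (∀ e₀ : E₀ →ₗ[Q] E₁, e₁ ∘ₗ e₀ = f • (LinearMap.id : E₀ →ₗ[Q] E₀) →
      e₀ ∘ₗ e₁ = f • (LinearMap.id : E₁ →ₗ[Q] E₁)) ∧
    Nonempty ((E₀ ⧸ LinearMap.range e₁) ≃ₗ[Q] M) := by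
  have hex : ∀ x : E₀, ∃ y : E₁, e₁ y = f • x := by
    intro x
    have h : f • x ∈ LinearMap.ker π := by
      rw [LinearMap.mem_ker, map_smul, hM]
    rw [hker] at h
    exact h
  choose g hg using hex
  refine ⟨⟨{ toFun := g, map_add' := ?_, map_smul' := ?_ }, ?_, ?_⟩, ?_, ?_⟩
  · intro x y
    apply hinj
    rw [map_add, hg, hg, hg, smul_add]
  · intro c x
    apply hinj
    rw [RingHom.id_apply, map_smul, hg, hg, smul_comm]
  · ext x
    exact hg x
  · intro e he
    ext x
    apply hinj
    exact (LinearMap.congr_fun he x).trans (hg x).symm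
  · intro e he
    ext x
    apply hinj
    have h := LinearMap.congr_fun he (e₁ x)
    refine h.trans ?_
    simp
  · exact ⟨(Submodule.quotEquivOfEq _ _ hker.symm).trans (π.quotKerEquivOfSurjective hsurj)⟩
end

section
/- Let Q be a commutative ring, f ∈ Q a nonzerodivisor, and R = Q/(f). Then every finitely generated projective R-module P, regarded as a Q-module via the quotient map Q → R, admits a resolution 0 → P₁ → P₀ → P → 0 by finitely generated projective Q-modules; that is, P has projective dimension at most 1 over Q. -/
universe u

/-- Let `f` be a nonzerodivisor in a commutative ring `Q` and
`R = Q/(f)`.  Every finitely generated projective `R`-module `P`, regarded as a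
`Q`-module, admits a resolution `0 → P₁ → P₀ → P → 0` by finitely generated projective
`Q`-modules; i.e. `P` has projective dimension at most `1` over `Q`. -/
theorem stmt_7 (Q : Type u) [CommRing Q] (f : Q) (hf : f ∈ nonZeroDivisors Q)
    (P : Type u) [AddCommGroup P] [Module Q P]
    [Module (Q ⧸ Ideal.span {f}) P] [IsScalarTower Q (Q ⧸ Ideal.span {f}) P]
    [Module.Finite (Q ⧸ Ideal.span {f}) P] [Module.Projective (Q ⧸ Ideal.span {f}) P] :
    ∃ (P₀ P₁ : ModuleCat.{u} Q), Module.Finite Q P₀ ∧ Module.Projective Q P₀ ∧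
      Module.Finite Q P₁ ∧ Module.Projective Q P₁ ∧
      ∃ (g : P₁ →ₗ[Q] P₀) (h : P₀ →ₗ[Q] P),
        Function.Injective g ∧ Function.Surjective h ∧
        LinearMap.range g = LinearMap.ker h := by
  obtain ⟨n, π₀, hπ₀⟩ := Module.Finite.exists_fin' (Q ⧸ Ideal.span {f}) P
  obtain ⟨σ, hσ⟩ := Module.projective_lifting_property π₀ LinearMap.id hπ₀
  let q : (Fin n → Q) →ₗ[Q] (Fin n → Q ⧸ Ideal.span {f}) :=
    (Submodule.mkQ (Ideal.span {f})).compLeft (Fin n)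
  have hqa : ∀ x i, q x i = Ideal.Quotient.mk (Ideal.span {f}) (x i) := fun _ _ => rfl
  have hq : Function.Surjective q := fun y => by
    choose x hx using fun i => Ideal.Quotient.mk_surjective (y i)
    exact ⟨x, funext hx⟩
  have hfR : ∀ x : Fin n → Q, q (f • x) = 0 := fun x => by
    funext i
    rw [hqa]
    simp only [Pi.smul_apply, smul_eq_mul, Pi.zero_apply]
    exact Ideal.Quotient.eq_zero_iff_mem.2
      (Ideal.mul_mem_right _ _ (Ideal.mem_span_singleton_self f))
  have hker : ∀ x, q x = 0 → ∃ y : Fin n → Q, f • y = x := fun x hx => by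
    have : ∀ i, ∃ y, x i = f * y := fun i => by
      have := congrFun hx i
      rw [hqa] at this
      exact Ideal.mem_span_singleton.1 (Ideal.Quotient.eq_zero_iff_mem.1 this)
    choose y hy using this
    exact ⟨y, funext fun i => (hy i).symm⟩
  have hinj : ∀ x y : Fin n → Q, f • x = f • y → x = y := fun x y h => by
    funext i
    exact (mul_cancel_left_mem_nonZeroDivisors hf).1 (congrFun h i)
  let π : (Fin n → Q) →ₗ[Q] P := (π₀.restrictScalars Q) ∘ₗ q
  have hπ : Function.Surjective π := hπ₀.comp hq
  obtain ⟨E, hE⟩ := Module.projective_lifting_property q ((σ.restrictScalars Q) ∘ₗ π) hq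
  have hE' : ∀ x, q (E x) = σ (π x) := fun x => LinearMap.congr_fun hE x
  have hπE : ∀ x, π (E x) = π x := fun x => by
    change π₀ (q (E x)) = π x
    rw [hE']
    exact LinearMap.congr_fun hσ _
  have hfK : ∀ x, f • x ∈ LinearMap.ker π := fun x => by
    change π₀ (q (f • x)) = 0
    rw [hfR, map_zero]
  have hd : ∀ k : LinearMap.ker π, ∃ y : Fin n → Q, f • y = E k := fun k => by
    apply hker
    rw [hE', LinearMap.mem_ker.1 k.2, map_zero]
  choose d hd using hd
  let s : LinearMap.ker π →ₗ[Q] (Fin n → Q) × (Fin n → Q) :=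
    LinearMap.prod
      { toFun := d
        map_add' := fun a b => hinj _ _ (by rw [smul_add, hd, hd, hd]; simp)
        map_smul' := fun c a => hinj _ _ (by
          rw [RingHom.id_apply, smul_comm, hd, hd]; simp) }
      (LinearMap.ker π).subtype
  let p : (Fin n → Q) × (Fin n → Q) →ₗ[Q] LinearMap.ker π :=
    LinearMap.codRestrict _
      (LinearMap.coprod (f • LinearMap.id) (LinearMap.id - E)) (fun c => by
        have h1 := hfK c.1
        have h2 : c.2 - E c.2 ∈ LinearMap.ker π := by
          rw [LinearMap.mem_ker, map_sub, hπE, sub_self]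
        exact add_mem h1 h2)
  have hps : p ∘ₗ s = LinearMap.id := by
    ext1 k
    apply Subtype.ext
    change f • d k + ((k : Fin n → Q) - E k) = k
    rw [hd]; abel
  have hp : Function.Surjective p := fun k => ⟨s k, LinearMap.congr_fun hps k⟩
  refine ⟨ModuleCat.of Q (Fin n → Q), ModuleCat.of Q (LinearMap.ker π),
    inferInstanceAs (Module.Finite Q (Fin n → Q)),
    inferInstanceAs (Module.Projective Q (Fin n → Q)),
    Module.Finite.of_surjective p hp, Module.Projective.of_split s p hps,
    (LinearMap.ker π).subtype, π, Subtype.val_injective, hπ, Submodule.range_subtype _⟩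
end

section
/- Let Q be a commutative ring, f ∈ Q a nonzerodivisor, and let (E₁, E₀, e₁, e₀) and (F₁, F₀, f₁, f₀) be matrix factorizations of f over Q with E₁, E₀, F₁, F₀ projective Q-modules. Set N = F₀/f₁(F₁) with quotient map p : F₀ → N (note f • N = 0). Define ℤ-indexed cochain complexes C and D of Q-modules as follows: for every m ∈ ℤ, C^{2m} = Hom_Q(E₀,F₀) ⊕ Hom_Q(E₁,F₁) and C^{2m+1} = Hom_Q(E₀,F₁) ⊕ Hom_Q(E₁,F₀), with differentials C^{2m} → C^{2m+1} given by (c,d) ↦ (f₀ ∘ c + d ∘ e₀, c ∘ e₁ + f₁ ∘ d) and C^{2m+1} → C^{2m+2} given by (a,b) ↦ (f₁ ∘ a − b ∘ e₀, −a ∘ e₁ + f₀ ∘ b); D^{2m} = Hom_Q(E₀, N) and D^{2m+1} = Hom_Q(E₁, N), with differentials D^{2m} → D^{2m+1} given by φ ↦ φ ∘ e₁ and D^{2m+1} → D^{2m+2} given by ψ ↦ −ψ ∘ e₀. Then the degreewise surjective chain map C → D given in degree 2m by (c,d) ↦ p ∘ c and in degree 2m+1 by (a,b) ↦ p ∘ b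 is a quasi-isomorphism, i.e., it induces isomorphisms on cohomology in every degree. -/
/-- For matrix factorizations `(E₁, E₀, e₁, e₀)` and `(F₁, F₀, f₁, f₀)`
of a nonzerodivisor `f` over `Q` with projective components, set `N = F₀/f₁(F₁)` with
quotient map `p`.  The two-periodic mapping complex `C` with even terms
`Hom(E₀,F₀) ⊕ Hom(E₁,F₁)` and odd terms `Hom(E₀,F₁) ⊕ Hom(E₁,F₀)` maps onto the
two-periodic complex `D` with even terms `Hom(E₀,N)` and odd terms `Hom(E₁,N)` by
`(c,d) ↦ p∘c` in even degrees and `(a,b) ↦ p∘b` in odd degrees; this degreewise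
surjective chain map is a quasi-isomorphism, i.e. it induces isomorphisms on cohomology
in every (even and odd) degree. -/
theorem stmt_9 (Q : Type*) [CommRing Q] (f : Q) (hf : f ∈ nonZeroDivisors Q)
    (E₁ E₀ F₁ F₀ : Type*)
    [AddCommGroup E₁] [AddCommGroup E₀] [AddCommGroup F₁] [AddCommGroup F₀]
    [Module Q E₁] [Module Q E₀] [Module Q F₁] [Module Q F₀]
    [Module.Projective Q E₁] [Module.Projective Q E₀]
    [Module.Projective Q F₁] [Module.Projective Q F₀]
    (e₁ : E₁ →ₗ[Q] E₀) (e₀ : E₀ →ₗ[Q] E₁)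
    (f₁ : F₁ →ₗ[Q] F₀) (f₀ : F₀ →ₗ[Q] F₁)
    (hE₁ : e₀ ∘ₗ e₁ = f • (LinearMap.id : E₁ →ₗ[Q] E₁))
    (hE₂ : e₁ ∘ₗ e₀ = f • (LinearMap.id : E₀ →ₗ[Q] E₀))
    (hF₁ : f₀ ∘ₗ f₁ = f • (LinearMap.id : F₁ →ₗ[Q] F₁))
    (hF₂ : f₁ ∘ₗ f₀ = f • (LinearMap.id : F₀ →ₗ[Q] F₀)) :
    let N := F₀ ⧸ LinearMap.range f₁
    let p : F₀ →ₗ[Q] N := Submodule.mkQ (LinearMap.range f₁)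
    let d₀ : ((E₀ →ₗ[Q] F₀) × (E₁ →ₗ[Q] F₁)) → ((E₀ →ₗ[Q] F₁) × (E₁ →ₗ[Q] F₀)) :=
      fun cd => (f₀ ∘ₗ cd.1 + cd.2 ∘ₗ e₀, cd.1 ∘ₗ e₁ + f₁ ∘ₗ cd.2)
    let d₁ : ((E₀ →ₗ[Q] F₁) × (E₁ →ₗ[Q] F₀)) → ((E₀ →ₗ[Q] F₀) × (E₁ →ₗ[Q] F₁)) :=
      fun ab => (f₁ ∘ₗ ab.1 - ab.2 ∘ₗ e₀, -(ab.1 ∘ₗ e₁) + f₀ ∘ₗ ab.2)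
    let δ₀ : (E₀ →ₗ[Q] N) → (E₁ →ₗ[Q] N) := fun φ => φ ∘ₗ e₁
    let δ₁ : (E₁ →ₗ[Q] N) → (E₀ →ₗ[Q] N) := fun ψ => -(ψ ∘ₗ e₀)
    let pev : ((E₀ →ₗ[Q] F₀) × (E₁ →ₗ[Q] F₁)) → (E₀ →ₗ[Q] N) := fun cd => p ∘ₗ cd.1
    let pod : ((E₀ →ₗ[Q] F₁) × (E₁ →ₗ[Q] F₀)) → (E₁ →ₗ[Q] N) := fun ab => p ∘ₗ ab.2
    -- the maps `pev`, `pod` form a degreewise surjective chain map from `C` to `D`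
    (∀ cd, δ₀ (pev cd) = pod (d₀ cd)) ∧
    (∀ ab, δ₁ (pod ab) = pev (d₁ ab)) ∧
    Function.Surjective pev ∧ Function.Surjective pod ∧
    -- injectivity on cohomology in even and odd degrees
    (∀ x, d₀ x = 0 → pev x ∈ Set.range δ₁ → x ∈ Set.range d₁) ∧
    (∀ y, d₁ y = 0 → pod y ∈ Set.range δ₀ → y ∈ Set.range d₀) ∧
    -- surjectivity on cohomology in even and odd degrees
    (∀ φ, δ₀ φ = 0 → ∃ x, d₀ x = 0 ∧ pev x - φ ∈ Set.range δ₁) ∧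
    (∀ ψ, δ₁ ψ = 0 → ∃ y, d₁ y = 0 ∧ pod y - ψ ∈ Set.range δ₀) := by
  have inj : ∀ x : F₁, f₁ x = 0 → x = 0 := by
    intro x hx
    have h1 : f • x = 0 := by
      have := LinearMap.congr_fun hF₁ x
      simp [hx] at this
      exact this.symm
    obtain ⟨s, hs⟩ := Module.projective_def'.mp (inferInstance : Module.Projective Q F₁)
    have h2 : f • s x = 0 := by rw [← map_smul, h1, map_zero]
    have h3 : s x = 0 := by
      ext i
      have h4 := DFunLike.congr_fun h2 i
      simp only [Finsupp.smul_apply, smul_eq_mul, Finsupp.zero_apply] at h4 ⊢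
      exact (mem_nonZeroDivisors_iff.mp hf).1 _ h4
    have h5 := LinearMap.congr_fun hs x
    simp only [LinearMap.comp_apply, h3, map_zero, LinearMap.id_apply] at h5
    exact h5.symm
  have injE : ∀ x y : F₁, f₁ x = f₁ y → x = y := by
    intro x y h
    exact sub_eq_zero.mp (inj _ (by rw [map_sub, h, sub_self]))
  have E1 : ∀ x, e₀ (e₁ x) = f • x := fun x => LinearMap.congr_fun hE₁ x
  have E2 : ∀ x, e₁ (e₀ x) = f • x := fun x => LinearMap.congr_fun hE₂ x
  have F2 : ∀ x, f₁ (f₀ x) = f • x := fun x => LinearMap.congr_fun hF₂ x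
  intro N p d₀ d₁ δ₀ δ₁ pev pod
  have pf : ∀ x, p (f₁ x) = 0 := fun x =>
    (Submodule.Quotient.mk_eq_zero _).mpr ⟨x, rfl⟩
  have psurj : Function.Surjective p := Submodule.mkQ_surjective _
  have lift0 : ∀ φ : E₀ →ₗ[Q] N, ∃ c, p ∘ₗ c = φ := fun φ =>
    Module.projective_lifting_property p φ psurj
  have lift1 : ∀ φ : E₁ →ₗ[Q] N, ∃ c, p ∘ₗ c = φ := fun φ =>
    Module.projective_lifting_property p φ psurj
  let e : F₁ ≃ₗ[Q] LinearMap.range f₁ := LinearEquiv.ofInjective f₁ (fun x y h => injE x y h)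
  have ker0 : ∀ g : E₀ →ₗ[Q] F₀, (∀ x, p (g x) = 0) → ∃ a : E₀ →ₗ[Q] F₁, ∀ x, f₁ (a x) = g x := by
    intro g hg
    refine ⟨e.symm.toLinearMap ∘ₗ g.codRestrict (LinearMap.range f₁)
      (fun x => (Submodule.Quotient.mk_eq_zero _).mp (hg x)), fun x => ?_⟩
    exact congrArg Subtype.val (e.apply_symm_apply _)
  have ker1 : ∀ g : E₁ →ₗ[Q] F₀, (∀ x, p (g x) = 0) → ∃ a : E₁ →ₗ[Q] F₁, ∀ x, f₁ (a x) = g x := by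
    intro g hg
    refine ⟨e.symm.toLinearMap ∘ₗ g.codRestrict (LinearMap.range f₁)
      (fun x => (Submodule.Quotient.mk_eq_zero _).mp (hg x)), fun x => ?_⟩
    exact congrArg Subtype.val (e.apply_symm_apply _)
  refine ⟨?_, ?_, ?_, ?_, ?_, ?_, ?_, ?_⟩
  · rintro ⟨c, d⟩
    ext x
    change p (c (e₁ x)) = p (c (e₁ x) + f₁ (d x))
    rw [map_add, pf, add_zero]
  · rintro ⟨a, b⟩
    ext x
    change -p (b (e₀ x)) = p (f₁ (a x) - b (e₀ x))
    rw [map_sub, pf, zero_sub]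
  · intro φ
    obtain ⟨c, hc⟩ := lift0 φ
    exact ⟨(c, 0), hc⟩
  · intro φ
    obtain ⟨c, hc⟩ := lift1 φ
    exact ⟨(0, c), hc⟩
  · rintro ⟨c, d⟩ hx ⟨ψ, hψ⟩
    obtain ⟨b, rfl⟩ := lift1 ψ
    have h2 : ∀ x, c (e₁ x) + f₁ (d x) = 0 := fun x => LinearMap.congr_fun (congrArg Prod.snd hx) x
    have h3 : ∀ x, -p (b (e₀ x)) = p (c x) := fun x => LinearMap.congr_fun hψ x
    obtain ⟨a, ha⟩ := ker0 (c + b ∘ₗ e₀) (fun x => by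
      change p (c x + b (e₀ x)) = 0
      rw [map_add, ← h3, neg_add_cancel])
    replace ha : ∀ x, f₁ (a x) = c x + b (e₀ x) := ha
    refine ⟨(a, b), Prod.ext (LinearMap.ext fun x => ?_) (LinearMap.ext fun x => ?_)⟩
    · change f₁ (a x) - b (e₀ x) = c x
      rw [ha, add_sub_cancel_right]
    · change -(a (e₁ x)) + f₀ (b x) = d x
      apply injE
      rw [map_add, map_neg, ha, F2, E1, map_smul, eq_neg_of_add_eq_zero_right (h2 x)]
      abel
  · rintro ⟨a, b⟩ hy ⟨φ, hφ⟩
    obtain ⟨c, rfl⟩ := lift0 φ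
    have h1 : ∀ x, f₁ (a x) - b (e₀ x) = 0 := fun x => LinearMap.congr_fun (congrArg Prod.fst hy) x
    have h3 : ∀ x, p (c (e₁ x)) = p (b x) := fun x => LinearMap.congr_fun hφ x
    obtain ⟨d, hd⟩ := ker1 (b - c ∘ₗ e₁) (fun x => by
      change p (b x - c (e₁ x)) = 0
      rw [map_sub, ← h3, sub_self])
    replace hd : ∀ x, f₁ (d x) = b x - c (e₁ x) := hd
    refine ⟨(c, d), Prod.ext (LinearMap.ext fun x => ?_) (LinearMap.ext fun x => ?_)⟩
    · change f₀ (c x) + d (e₀ x) = a x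
      apply injE
      rw [map_add, hd, F2, E2, map_smul, sub_eq_zero.mp (h1 x)]
      abel
    · change c (e₁ x) + f₁ (d x) = b x
      rw [hd]
      abel
  · intro φ hφ
    obtain ⟨c, rfl⟩ := lift0 φ
    obtain ⟨d, hd⟩ := ker1 (c ∘ₗ e₁) (fun x => LinearMap.congr_fun hφ x)
    replace hd : ∀ x, f₁ (d x) = c (e₁ x) := hd
    refine ⟨(c, -d), Prod.ext (LinearMap.ext fun x => ?_) (LinearMap.ext fun x => ?_), 0, ?_⟩
    · change f₀ (c x) + -(d (e₀ x)) = 0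
      apply inj
      rw [map_add, map_neg, hd, F2, E2, map_smul, add_neg_cancel]
    · change c (e₁ x) + f₁ (-(d x)) = 0
      rw [map_neg, hd, add_neg_cancel]
    · change -((0 : E₁ →ₗ[Q] N) ∘ₗ e₀) = p ∘ₗ c - p ∘ₗ c
      rw [sub_self, LinearMap.zero_comp, neg_zero]
  · intro ψ hψ
    obtain ⟨b, rfl⟩ := lift1 ψ
    obtain ⟨a, ha⟩ := ker0 (b ∘ₗ e₀) (fun x => neg_eq_zero.mp (LinearMap.congr_fun hψ x))
    replace ha : ∀ x, f₁ (a x) = b (e₀ x) := ha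
    refine ⟨(a, b), Prod.ext (LinearMap.ext fun x => ?_) (LinearMap.ext fun x => ?_), 0, ?_⟩
    · change f₁ (a x) - b (e₀ x) = 0
      rw [ha, sub_self]
    · change -(a (e₁ x)) + f₀ (b x) = 0
      apply inj
      rw [map_add, map_neg, ha, F2, E1, map_smul, neg_add_cancel]
    · change (0 : E₀ →ₗ[Q] N) ∘ₗ e₁ = p ∘ₗ b - p ∘ₗ b
      rw [sub_self, LinearMap.zero_comp]
end

section
/- Let k be a field and let R = k[X,Y]/(X², Y²) be the quotient of the polynomial ring in two variables by the ideal generated by X² and Y². Regard k as an R-module via the k-algebra homomorphism R → k sending X and Y to 0. Then for every n ≥ 0, the R-module Tor_n^R(k, k) is isomorphic to k^{n+1} (the direct sum of n+1 copies of k, with R acting through R → k). In particular the k-dimensions of Tor_n^R(k,k) grow linearly in n, so k does not admit a periodic free resolution over R. -/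
universe u

open CategoryTheory

/-- The ring `R = k[X,Y]/(X², Y²)`. -/
abbrev stmt10R (k : Type u) [Field k] : Type u :=
  MvPolynomial (Fin 2) k ⧸
    Ideal.span {(MvPolynomial.X 0 : MvPolynomial (Fin 2) k) ^ 2, (MvPolynomial.X 1) ^ 2}

/-- The augmentation `R → k` sending `X` and `Y` to `0`. -/
noncomputable def stmt10Aug (k : Type u) [Field k] : stmt10R k →+* k :=
  Ideal.Quotient.lift _ (MvPolynomial.eval (0 : Fin 2 → k))
    (by
      intro a ha
      have h : Ideal.span
          ({(MvPolynomial.X 0 : MvPolynomial (Fin 2) k) ^ 2, (MvPolynomial.X 1) ^ 2} :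
            Set (MvPolynomial (Fin 2) k)) ≤
          RingHom.ker (MvPolynomial.eval (0 : Fin 2 → k)) := by
        rw [Ideal.span_le]
        intro p hp
        simp only [Set.mem_insert_iff, Set.mem_singleton_iff] at hp
        rcases hp with rfl | rfl <;> simp [RingHom.mem_ker]
      exact h ha)


section Stmt10Aux

open MonoidalCategory TensorProduct

/-- The differential of the resolution. -/
noncomputable def s10d {R : Type u} [CommRing R] (x y : R) (n : ℕ) :
    (Fin (n + 2) → R) →ₗ[R] (Fin (n + 1) → R) :=
  LinearMap.pi fun i => x • LinearMap.proj i.succ + ((-1) ^ (i : ℕ) * y) • LinearMap.proj i.castSucc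

lemma s10d_apply {R : Type u} [CommRing R] (x y : R) (n : ℕ) (v : Fin (n + 2) → R)
    (i : Fin (n + 1)) :
    s10d x y n v i = x * v i.succ + (-1) ^ (i : ℕ) * y * v i.castSucc := by
  simp [s10d]

lemma s10d_d {R : Type u} [CommRing R] (x y : R) (hx : x * x = 0) (hy : y * y = 0) (n : ℕ)
    (v : Fin (n + 3) → R) : s10d x y n (s10d x y (n + 1) v) = 0 := by
  funext i
  simp only [s10d_apply, Pi.zero_apply, Fin.val_succ, Fin.val_castSucc, Fin.succ_castSucc, pow_succ]
  linear_combination (v i.succ.succ) * hx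
    + (-1) ^ (i : ℕ) * (-1) ^ (i : ℕ) * v i.castSucc.castSucc * hy

/-- The complex. -/
noncomputable def s10C {R : Type u} [CommRing R] (x y : R) (hx : x * x = 0) (hy : y * y = 0) :
    ChainComplex (ModuleCat.{u} R) ℕ :=
  ChainComplex.of (fun n => ModuleCat.of R (Fin (n + 1) → R)) (fun n => ModuleCat.ofHom (s10d x y n))
    (fun n => by
      ext1
      exact LinearMap.ext fun v => s10d_d x y hx hy n v)

lemma s10C_d {R : Type u} [CommRing R] (x y : R) (hx : x * x = 0) (hy : y * y = 0) (n : ℕ) :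
    (s10C x y hx hy).d (n + 1) n = ModuleCat.ofHom (s10d x y n) := by
  exact ChainComplex.of_d (fun n => ModuleCat.of R (Fin (n + 1) → R))
    (fun n => ModuleCat.ofHom (s10d x y n)) n

lemma s10eps {R : Type u} [CommRing R] (x y : R)
    (K : Type u) [AddCommGroup K] [Module R K] (ε : R →ₗ[R] K)
    (hker : ∀ r, ε r = 0 ↔ ∃ a b, r = x * a + y * b) (v : Fin (0 + 2) → R) :
    ε (s10d x y 0 v 0) = 0 := by
  rw [hker, s10d_apply]
  exact ⟨v 1, v 0, by simp⟩

/-- The resolution. -/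
noncomputable def s10P {R : Type u} [CommRing R] (x y : R) (hx : x * x = 0) (hy : y * y = 0)
    (K : Type u) [AddCommGroup K] [Module R K] (ε : R →ₗ[R] K) (hε : Function.Surjective ε)
    (hker : ∀ r, ε r = 0 ↔ ∃ a b, r = x * a + y * b)
    (hex : ∀ n (v : Fin (n + 2) → R), s10d x y n v = 0 → ∃ w, s10d x y (n + 1) w = v) :
    ProjectiveResolution (ModuleCat.of R K) where
  complex := s10C x y hx hy
  projective n := by
    change Projective (ModuleCat.of R (Fin (n + 1) → R))
    exact (IsProjective.iff_projective (R := R) (Fin (n + 1) → R)).1 inferInstance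
  π := (ChainComplex.toSingle₀Equiv _ _).symm
    ⟨(ModuleCat.ofHom (ε ∘ₗ LinearMap.proj 0) :
        ModuleCat.of R (Fin (0 + 1) → R) ⟶ ModuleCat.of R K), by
      rw [s10C_d]
      ext1
      refine LinearMap.ext fun v => ?_
      change ε (s10d x y 0 v 0) = 0
      exact s10eps x y K ε hker v⟩
  quasiIso := ⟨fun n => by
    cases n with
    | zero =>
      rw [ChainComplex.quasiIsoAt₀_iff, ShortComplex.quasiIso_iff_of_zeros']
      · have h : (ShortComplex.mk (ModuleCat.ofHom (s10d x y 0))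
          (ModuleCat.ofHom (ε ∘ₗ LinearMap.proj 0)) (by
            ext1
            refine LinearMap.ext fun v => ?_
            change ε (s10d x y 0 v 0) = 0
            exact s10eps x y K ε hker v)).Exact ∧ Epi (ModuleCat.ofHom (ε ∘ₗ LinearMap.proj (R := R) (φ := fun _ : Fin (0 + 1) => R) 0)) := by
          constructor
          · rw [ShortComplex.moduleCat_exact_iff]
            intro v hv
            obtain ⟨a, b, hab⟩ := (hker (v 0)).1 hv
            refine ⟨![b, a], ?_⟩
            funext i
            change s10d x y 0 ![b, a] i = v i
            rw [s10d_apply]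
            have : i = 0 := Subsingleton.elim (α := Fin 1) _ _
            subst this
            simpa using hab.symm
          · rw [ModuleCat.epi_iff_surjective]
            intro z
            obtain ⟨r, hr⟩ := hε z
            exact ⟨fun _ => r, hr⟩
        refine (ShortComplex.exact_and_epi_g_iff_of_iso ?_).2 h
        exact ShortComplex.isoMk (Iso.refl _) (Iso.refl _) (Iso.refl _)
          (by
            simp only [Iso.refl_hom]
            exact ((Category.comp_id _).trans (s10C_d x y hx hy 0)).symm)
          (by
            simp only [Iso.refl_hom]
            refine Eq.trans ?_ (Category.comp_id _).symm
            exact (ChainComplex.toSingle₀Equiv_symm_apply_f_zero (C := s10C x y hx hy)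
              (X := ModuleCat.of R K) (ModuleCat.ofHom (ε ∘ₗ LinearMap.proj 0) :
                ModuleCat.of R (Fin (0 + 1) → R) ⟶ ModuleCat.of R K) _).symm)
      all_goals rfl
    | succ n =>
      rw [quasiIsoAt_iff_exactAt']
      · rw [HomologicalComplex.exactAt_iff' _ (n + 1 + 1) (n + 1) n (by simp) (by simp)]
        rw [ShortComplex.moduleCat_exact_iff]
        intro v hv
        change ((s10C x y hx hy).d (n + 1) n) v = 0 at hv
        change ∃ w, ((s10C x y hx hy).d (n + 1 + 1) (n + 1)) w = v
        rw [s10C_d] at hv ⊢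
        exact hex n v hv
      · apply ChainComplex.exactAt_succ_single_obj⟩

lemma s10tensor {R : Type u} [CommRing R] (x y : R) 
    (K : Type u) [AddCommGroup K] [Module R K]
    (hxK : ∀ z : K, x • z = 0) (hyK : ∀ z : K, y • z = 0) (n : ℕ) :
    LinearMap.lTensor K (s10d x y n) = 0 := by
  refine TensorProduct.ext' fun z v => ?_
  have : s10d x y n v = x • (fun i : Fin (n + 1) => v i.succ) +
      y • (fun i : Fin (n + 1) => (-1) ^ (i : ℕ) * v i.castSucc) := by
    funext i
    rw [s10d_apply]
    simp
    ring
  rw [LinearMap.lTensor_tmul, this, TensorProduct.tmul_add, ← TensorProduct.smul_tmul,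
    ← TensorProduct.smul_tmul, hxK, hyK]
  simp

lemma s10main {R : Type u} [CommRing R] (x y : R) (hx : x * x = 0) (hy : y * y = 0)
    (K : Type u) [AddCommGroup K] [Module R K] (ε : R →ₗ[R] K) (hε : Function.Surjective ε)
    (hker : ∀ r, ε r = 0 ↔ ∃ a b, r = x * a + y * b)
    (hex : ∀ n (v : Fin (n + 2) → R), s10d x y n v = 0 → ∃ w, s10d x y (n + 1) w = v)
    (hxK : ∀ z : K, x • z = 0) (hyK : ∀ z : K, y • z = 0) (n : ℕ) :
    Nonempty
      ((((Tor (ModuleCat.{u} R) n).obj (ModuleCat.of R K)).obj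
          (ModuleCat.of R K)) ≃ₗ[R] (Fin (n + 1) → K)) := by
  let P := s10P x y hx hy K ε hε hker hex
  let F := (tensoringLeft (ModuleCat.{u} R)).obj (ModuleCat.of R K)
  let i1 := P.isoLeftDerivedObj F n
  let D := (F.mapHomologicalComplex (ComplexShape.down ℕ)).obj P.complex
  have hD : ∀ m, D.d (m + 1) m = 0 := by
    intro m
    change F.map ((s10C x y hx hy).d (m + 1) m) = 0
    rw [s10C_d]
    ext1
    exact s10tensor x y K hxK hyK m
  have hD' : ∀ i j, D.d i j = 0 := by
    intro i j
    by_cases h : j + 1 = i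
    · subst h; exact hD j
    · exact D.shape _ _ h
  let i2 : D.homology n ≅ D.X n :=
    (ShortComplex.HomologyData.ofZeros (D.sc n) (hD' _ _) (hD' _ _)).left.homologyIso
  have e3 : (D.X n : Type u) ≃ₗ[R] (Fin (n + 1) → K) :=
    TensorProduct.piScalarRight R R K (Fin (n + 1))
  exact ⟨(i1 ≪≫ i2).toLinearEquiv.trans e3⟩

variable (k : Type u) [Field k]

noncomputable abbrev s10x : stmt10R k := Ideal.Quotient.mk _ (MvPolynomial.X 0)
noncomputable abbrev s10y : stmt10R k := Ideal.Quotient.mk _ (MvPolynomial.X 1)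
noncomputable abbrev s10c : k →+* stmt10R k := (Ideal.Quotient.mk _).comp MvPolynomial.C

lemma s10xx : s10x k * s10x k = 0 := by
  rw [← map_mul, Ideal.Quotient.eq_zero_iff_mem, ← pow_two]
  exact Ideal.subset_span (by simp)

lemma s10yy : s10y k * s10y k = 0 := by
  rw [← map_mul, Ideal.Quotient.eq_zero_iff_mem, ← pow_two]
  exact Ideal.subset_span (by simp)

noncomputable def s10psi : MvPolynomial (Fin 2) k →+* DualNumber (DualNumber k) :=
  MvPolynomial.eval₂Hom
      ((TrivSqZeroExt.inlHom (DualNumber k) (DualNumber k)).comp (TrivSqZeroExt.inlHom k k))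
      ![(TrivSqZeroExt.inl DualNumber.eps : DualNumber (DualNumber k)), DualNumber.eps]

noncomputable def s10phi : stmt10R k →+* DualNumber (DualNumber k) :=
  Ideal.Quotient.lift _ (s10psi k)
    (by
      intro a ha
      refine (?_ : Ideal.span _ ≤ RingHom.ker (s10psi k)) ha
      rw [Ideal.span_le]
      intro p hp
      simp only [Set.mem_insert_iff, Set.mem_singleton_iff] at hp
      rcases hp with rfl | rfl <;>
        simp [s10psi, RingHom.mem_ker, pow_two, ← TrivSqZeroExt.inl_mul])

lemma s10phi_x : s10phi k (s10x k) = TrivSqZeroExt.inl DualNumber.eps := by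
  simp [s10phi, s10psi]
lemma s10phi_y : s10phi k (s10y k) = DualNumber.eps := by
  simp [s10phi, s10psi]
lemma s10phi_c (a : k) : s10phi k (s10c k a) = TrivSqZeroExt.inl (TrivSqZeroExt.inl a) := by
  simp [s10phi, s10psi]

lemma s10decomp (r : stmt10R k) : ∃ a b c e : k, r = s10c k a + s10c k b * s10x k
    + s10c k c * s10y k + s10c k e * (s10x k * s10y k) := by
  obtain ⟨p, rfl⟩ := Ideal.Quotient.mk_surjective r
  have hx := s10xx k
  have hy := s10yy k
  induction p using MvPolynomial.induction_on with
  | C a => exact ⟨a, 0, 0, 0, by simp⟩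
  | add p q hp hq =>
    obtain ⟨a, b, c, e, h⟩ := hp
    obtain ⟨a', b', c', e', h'⟩ := hq
    refine ⟨a + a', b + b', c + c', e + e', ?_⟩
    rw [map_add, h, h']
    simp only [map_add]
    ring
  | mul_X p i hp =>
    obtain ⟨a, b, c, e, h⟩ := hp
    rw [map_mul, h]
    fin_cases i
    · refine ⟨0, a, 0, c, ?_⟩
      change _ * s10x k = _
      simp only [map_zero]
      linear_combination (s10c k b + s10c k e * s10y k) * hx
    · refine ⟨0, 0, a, b, ?_⟩
      change _ * s10y k = _
      simp only [map_zero]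
      linear_combination (s10c k c + s10c k e * s10x k) * hy

lemma s10indep (a b c e : k) (h : s10c k a + s10c k b * s10x k
    + s10c k c * s10y k + s10c k e * (s10x k * s10y k) = 0) : a = 0 ∧ b = 0 ∧ c = 0 ∧ e = 0 := by
  have h2 := congrArg (s10phi k) h
  simp only [map_add, map_mul, s10phi_x, s10phi_y, s10phi_c, map_zero] at h2
  have h3 := congrArg (fun z => z.fst.fst) h2
  have h4 := congrArg (fun z => z.fst.snd) h2
  have h5 := congrArg (fun z => z.snd.fst) h2
  have h6 := congrArg (fun z => z.snd.snd) h2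
  simp at h3 h4 h5 h6
  exact ⟨h3, h4, h5, h6⟩

lemma s10exact (n : ℕ) (v : Fin (n + 2) → stmt10R k) (hv : s10d (s10x k) (s10y k) n v = 0) :
    ∃ w, s10d (s10x k) (s10y k) (n + 1) w = v := by
  have hx := s10xx k
  have hy := s10yy k
  choose a b c e h using fun i => s10decomp k (v i)
  have key : ∀ i : Fin (n + 1), a i.succ = 0 ∧ a i.castSucc = 0 ∧
      c i.succ + (-1) ^ (i : ℕ) * b i.castSucc = 0 := by
    intro i
    have h1 := congrFun hv i
    rw [s10d_apply, h, h i.castSucc, Pi.zero_apply] at h1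
    have h2 := s10indep k 0 (a i.succ) ((-1) ^ (i : ℕ) * a i.castSucc)
      (c i.succ + (-1) ^ (i : ℕ) * b i.castSucc) (by
        simp only [map_zero, map_add, map_mul, map_pow, map_neg, map_one]
        linear_combination h1 - (s10c k (b i.succ) + s10c k (e i.succ) * s10y k) * hx
          - (-1) ^ (i : ℕ) * (s10c k (c i.castSucc) + s10c k (e i.castSucc) * s10x k) * hy)
    obtain ⟨-, h3, h4, h5⟩ := h2
    exact ⟨h3, by simpa using h4, h5⟩
  have ha : ∀ i, a i = 0 := by
    intro i
    refine Fin.cases ?_ (fun j => (key j).1) i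
    exact (key 0).2.1
  refine ⟨Fin.cons (s10c k (c 0)) (fun i => s10c k (b i) + s10c k (e i) * s10y k), ?_⟩
  funext i
  rw [s10d_apply, h i, ha i, Fin.cons_succ]
  refine Fin.cases ?_ (fun j => ?_) i
  · simp
    ring
  · have hc : c j.succ = - ((-1) ^ (j : ℕ) * b j.castSucc) := by
      linear_combination (key j).2.2
    rw [← Fin.succ_castSucc, Fin.cons_succ, hc]
    simp only [map_zero, map_mul, map_pow, map_neg, map_one, Fin.val_succ, pow_succ]
    linear_combination (- (-1) ^ (j : ℕ) * s10c k (e j.castSucc)) * hy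

lemma s10aug_x : stmt10Aug k (s10x k) = 0 := by simp [stmt10Aug]
lemma s10aug_y : stmt10Aug k (s10y k) = 0 := by simp [stmt10Aug]
lemma s10aug_c (a : k) : stmt10Aug k (s10c k a) = a := by simp [stmt10Aug]

end Stmt10Aux

/-- Let `k` be a field, `R = k[X,Y]/(X², Y²)`, and regard `k` as an
`R`-module via the augmentation `X, Y ↦ 0`.  Then for every `n ≥ 0`,
`Tor_n^R(k, k)` is isomorphic as an `R`-module to `k^{n+1}`. -/
theorem stmt_10 (k : Type u) [Field k] (n : ℕ) :
    letI : Module (stmt10R k) k := Module.compHom k (stmt10Aug k)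
    Nonempty
      ((((Tor (ModuleCat.{u} (stmt10R k)) n).obj (ModuleCat.of (stmt10R k) k)).obj
          (ModuleCat.of (stmt10R k) k)) ≃ₗ[stmt10R k] (Fin (n + 1) → k)) := by
  letI : Module (stmt10R k) k := Module.compHom k (stmt10Aug k)
  have hsm : ∀ (r : stmt10R k) (z : k), r • z = stmt10Aug k r * z := fun _ _ => rfl
  refine s10main (s10x k) (s10y k) (s10xx k) (s10yy k) k
    { toFun := stmt10Aug k
      map_add' := map_add _
      map_smul' := fun r s => by simp [hsm] } ?_ ?_ (s10exact k) ?_ ?_ n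
  · exact fun z => ⟨s10c k z, s10aug_c k z⟩
  · intro r
    change stmt10Aug k r = 0 ↔ _
    constructor
    · intro hr
      obtain ⟨a, b, c, e, h⟩ := s10decomp k r
      have : a = 0 := by
        rw [h] at hr
        simpa only [map_add, map_mul, s10aug_x, s10aug_y, s10aug_c, mul_zero, add_zero] using hr
      subst this
      refine ⟨s10c k b, s10c k c + s10c k e * s10x k, ?_⟩
      rw [h, map_zero]
      ring
    · rintro ⟨a, b, rfl⟩
      simp only [map_add, map_mul, s10aug_x, s10aug_y, zero_mul, add_zero]
  · intro z
    rw [hsm, s10aug_x, zero_mul]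
  · intro z
    rw [hsm, s10aug_y, zero_mul]
end
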